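/- arXiv:0805.2710 — 2 statements merged into one kernel-verified Lean document; each statement's English description precedes it below -/
import Mathlib

section
/- If there exists an at most countable collection S of pairwise independent generalized attractors of f whose basins of attraction cover m-almost every point of M and whose members are all irreducible, then S is unique (any other collection of pairwise independent irreducible generalized attractors whose basins cover m-a.e. equals S), and its cardinality l satisfies l = a = k, where a is the supremum of the cardinalities of collections of pairwise independent generalized attractors whose basins cover m-a.e., and k is the supremum of the lengths of co-chains of generalized attractors of f. -/
open MeasureTheory Filter Set Topology
open scoped ENNReal NNReal

/-- A metric on a topological space `P` (here: the space `𝒫` of Borel probability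
measures with the weak* topology) inducing its topology; `d` plays the role of `dist*`. -/
structure CompatibleMetric (P : Type*) [TopologicalSpace P] where
  d : P → P → ℝ
  symm : ∀ x y, d x y = d y x
  triangle : ∀ x y z, d x z ≤ d x y + d y z
  eq_iff_dist_eq_zero : ∀ x y, d x y = 0 ↔ x = y
  nhds_iff : ∀ (x : P) (s : Set P), s ∈ nhds x ↔ ∃ ε > 0, {y | d x y < ε} ⊆ s

/-- The diameter of a set of measures w.r.t. the metric `D.d`. -/
noncomputable def diamD {P : Type*} [TopologicalSpace P] (D : CompatibleMetric P)
    (A : Set P) : ℝ :=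
  sSup (Set.image2 D.d A A)

variable {M : Type*} [MeasurableSpace M] [TopologicalSpace M] [OpensMeasurableSpace M]

/-- The empirical measure `σ_{n+1,x} = (1/(n+1)) ∑_{j=0}^{n} δ_{f^j(x)}`
(index shifted so that it is defined for every `n : ℕ`). -/
noncomputable def empiric (f : M → M) (x : M) (n : ℕ) : ProbabilityMeasure M :=
  ⟨((n : ℝ≥0∞) + 1)⁻¹ • ∑ j ∈ Finset.range (n + 1), Measure.dirac (f^[j] x), by
    constructor
    rw [Measure.smul_apply, Measure.finset_sum_apply]
    simp only [measure_univ, Finset.sum_const, Finset.card_range, nsmul_eq_mul, mul_one,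
      smul_eq_mul]
    rw [Nat.cast_add, Nat.cast_one]
    exact ENNReal.inv_mul_cancel (by simp)
      (ENNReal.add_ne_top.2 ⟨ENNReal.natCast_ne_top n, ENNReal.one_ne_top⟩)⟩

/-- `pω(x)`: the set of weak* limit points of the sequence of empirical measures
of the orbit of `x`. -/
def pomega (f : M → M) (x : M) : Set (ProbabilityMeasure M) :=
  {μ | MapClusterPt μ atTop (empiric f x)}

/-- The basin of attraction `B(K) = {x : pω(x) ⊆ K}` of a set of probability measures. -/
def basin (f : M → M) (K : Set (ProbabilityMeasure M)) : Set M :=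
  {x | pomega f x ⊆ K}

/-- `μ` is observable: for all `ε > 0` the `ε`-basin of partial attraction
`A_ε(μ) = {x : dist*(pω(x), μ) < ε}` has positive `m`-measure. -/
def Observable (D : CompatibleMetric (ProbabilityMeasure M)) (m : Measure M)
    (f : M → M) (μ : ProbabilityMeasure M) : Prop :=
  ∀ ε > 0, 0 < m {x | ∃ ν ∈ pomega f x, D.d ν μ < ε}

/-- `μ` is a physical measure: its basin `{x : pω(x) = {μ}}` has positive `m`-measure. -/
def PhysicalMeasure (m : Measure M) (f : M → M) (μ : ProbabilityMeasure M) : Prop :=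
  0 < m {x | pomega f x = {μ}}

/-- A generalized attractor (reduction of the set `𝒪` of observable measures): a nonempty
weak*-compact set of observable measures whose basin has positive `m`-measure. -/
def GenAttractor (D : CompatibleMetric (ProbabilityMeasure M)) (m : Measure M)
    (f : M → M) (A : Set (ProbabilityMeasure M)) : Prop :=
  A.Nonempty ∧ IsCompact A ∧ (∀ μ ∈ A, Observable D m f μ) ∧ 0 < m (basin f A)

/-- Two generalized attractors are independent if the basin of their intersection is null. -/
def IndepGA (m : Measure M) (f : M → M) (A B : Set (ProbabilityMeasure M)) : Prop :=
  m (basin f (A ∩ B)) = 0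

/-- A co-chain: an (at most countable) family of pairwise independent generalized attractors. -/
def IsCochain (D : CompatibleMetric (ProbabilityMeasure M)) (m : Measure M) (f : M → M)
    (S : Set (Set (ProbabilityMeasure M))) : Prop :=
  S.Countable ∧ (∀ A ∈ S, GenAttractor D m f A) ∧ S.Pairwise (IndepGA m f)

/-- A chain: a (finite or countably infinite) sequence, indexed by `I ⊆ ℕ`, of generalized
attractors that is strictly decreasing under inclusion. -/
def IsChainGA (D : CompatibleMetric (ProbabilityMeasure M)) (m : Measure M) (f : M → M)
    (I : Set ℕ) (c : ℕ → Set (ProbabilityMeasure M)) : Prop :=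
  I.Nonempty ∧ (∀ i ∈ I, GenAttractor D m f (c i)) ∧
    ∀ i ∈ I, ∀ j ∈ I, j < i → c i ⊂ c j

/-- Two chains are independent if each contains a member independent of some member
of the other. -/
def IndepChainPair (m : Measure M) (f : M → M)
    (p q : Set ℕ × (ℕ → Set (ProbabilityMeasure M))) : Prop :=
  (∃ i ∈ p.1, ∃ j ∈ q.1, IndepGA m f (p.2 i) (q.2 j)) ∧
    (∃ j ∈ q.1, ∃ i ∈ p.1, IndepGA m f (q.2 j) (p.2 i))

/-- `k`: the supremum of the lengths (cardinalities) of co-chains of generalized attractors. -/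
noncomputable def cochainSup (D : CompatibleMetric (ProbabilityMeasure M)) (m : Measure M)
    (f : M → M) : Cardinal :=
  sSup {c : Cardinal | ∃ S, IsCochain D m f S ∧ c = Cardinal.mk S}

/-- `h`: the supremum of the cardinalities of (at most countable) families of pairwise
independent chains of generalized attractors. -/
noncomputable def indepChainFamilySup (D : CompatibleMetric (ProbabilityMeasure M))
    (m : Measure M) (f : M → M) : Cardinal :=
  sSup {c : Cardinal | ∃ F : Set (Set ℕ × (ℕ → Set (ProbabilityMeasure M))),
    F.Countable ∧ (∀ p ∈ F, IsChainGA D m f p.1 p.2) ∧ F.Pairwise (IndepChainPair m f) ∧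
    c = Cardinal.mk F}

/-- An irreducible generalized attractor: one containing no proper compact subset that is
itself a generalized attractor. -/
def IrreducibleGA (D : CompatibleMetric (ProbabilityMeasure M)) (m : Measure M) (f : M → M)
    (A : Set (ProbabilityMeasure M)) : Prop :=
  GenAttractor D m f A ∧ ∀ K, IsCompact K → K ⊂ A → ¬ GenAttractor D m f K

theorem setOf_mapClusterPt_subset_iff_tendsto_infEDist {X : Type*} [MetricSpace X]
    [CompactSpace X] {A : Set X} (hA : IsClosed A) (u : ℕ → X) :
    {y | MapClusterPt y atTop u} ⊆ A ↔
      Tendsto (fun n => Metric.infEDist (u n) A) atTop (𝓝 0) := by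
  have hcont : Continuous fun y : X => Metric.infEDist y A := Metric.continuous_infEDist
  refine ⟨fun h => ENNReal.tendsto_nhds_zero.2 fun ε hε => ?_, fun h y hy => ?_⟩
  · by_contra hev
    have hfreq : ∃ᶠ n in atTop, u n ∈ {y : X | ε ≤ Metric.infEDist y A} :=
      (not_eventually.1 hev).mono fun n hn => (not_le.1 hn).le
    obtain ⟨y, hy, hcl⟩ :=
      (isClosed_le continuous_const hcont).isCompact.exists_mapClusterPt_of_frequently hfreq
    have hle : ε ≤ Metric.infEDist y A := hy
    rw [Metric.infEDist_zero_of_mem (h hcl)] at hle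
    exact hε.not_ge hle
  · have hcl : ClusterPt (Metric.infEDist y A) (𝓝 0) :=
      (MapClusterPt.continuousAt_comp hcont.continuousAt hy).clusterPt.mono h
    have : NeBot (𝓝 (Metric.infEDist y A) ⊓ 𝓝 0) := hcl
    exact (Metric.mem_iff_infEDist_zero_of_closed hA).2 (eq_of_nhds_neBot this)

theorem measurableSet_setOf_mapClusterPt_subset {X Y : Type*} [TopologicalSpace X]
    [TopologicalSpace.MetrizableSpace X] [CompactSpace X] [TopologicalSpace Y]
    [MeasurableSpace Y] [OpensMeasurableSpace Y] {A : Set X} (hA : IsClosed A)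
    {u : Y → ℕ → X} (hu : ∀ n, Continuous fun y => u y n) :
    MeasurableSet {y | {z | MapClusterPt z atTop (u y)} ⊆ A} := by
  let _ : MetricSpace X := TopologicalSpace.metrizableSpaceMetric X
  simp only [setOf_mapClusterPt_subset_iff_tendsto_infEDist hA]
  exact measurableSet_tendsto (𝓝 0) fun n =>
    (Metric.continuous_infEDist.comp (hu n)).measurable

theorem continuous_empiric {M : Type*} [MeasurableSpace M] [TopologicalSpace M]
    [OpensMeasurableSpace M] {f : M → M} (hf : Continuous f) (n : ℕ) :
    Continuous fun x => empiric f x n := by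
  refine continuous_iff_continuousAt.2 fun x =>
    ProbabilityMeasure.tendsto_iff_forall_integral_tendsto.2 fun g => ?_
  have key : ∀ y, ∫ z, g z ∂(empiric f y n : Measure M) =
      ((n : ℝ≥0∞) + 1)⁻¹.toReal • ∑ j ∈ Finset.range (n + 1), g (f^[j] y) := fun y => by
    have hdirac : ∀ a : M, ∫ z, g z ∂(Measure.dirac a) = g a := fun a =>
      integral_dirac' g a g.continuous.stronglyMeasurable
    change ∫ z, g z ∂(((n : ℝ≥0∞) + 1)⁻¹ • ∑ j ∈ Finset.range (n + 1), Measure.dirac (f^[j] y)) = _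
    rw [integral_smul_measure, integral_finsetSum_measure fun j _ => g.integrable _]
    simp only [hdirac]
  simp only [key]
  have hsum : Continuous fun y => ∑ j ∈ Finset.range (n + 1), g (f^[j] y) :=
    continuous_finsetSum _ fun j _ => g.continuous.comp (hf.iterate j)
  exact (hsum.tendsto x).const_smul _

theorem basin_inter {M : Type*} [MeasurableSpace M] [TopologicalSpace M]
    [OpensMeasurableSpace M] (f : M → M) (A B : Set (ProbabilityMeasure M)) :
    basin f (A ∩ B) = basin f A ∩ basin f B :=
  Set.ext fun _ => subset_inter_iff

section

variable {M : Type*} [MetricSpace M] [CompactSpace M] [MeasurableSpace M] [BorelSpace M]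
  {D : CompatibleMetric (ProbabilityMeasure M)} {m : Measure M} {f : M → M}
  {A B : Set (ProbabilityMeasure M)} {S T : Set (Set (ProbabilityMeasure M))}

theorem pomega_nonempty (f : M → M) (x : M) : (pomega f x).Nonempty := by
  obtain ⟨μ, -, hμ⟩ := isCompact_univ.exists_mapClusterPt_of_frequently
    (l := atTop) (f := empiric f x) (Frequently.of_forall fun _ => mem_univ _)
  exact ⟨μ, hμ⟩

theorem basin_empty (f : M → M) : basin f ∅ = ∅ :=
  eq_empty_of_forall_notMem fun x hx =>
    (pomega_nonempty f x).ne_empty (subset_empty_iff.1 hx)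

theorem measurableSet_basin (hf : Continuous f) (hA : IsCompact A) :
    MeasurableSet (basin f A) :=
  measurableSet_setOf_mapClusterPt_subset hA.isClosed (continuous_empiric hf)

theorem GenAttractor.inter (hA : GenAttractor D m f A) (hB : GenAttractor D m f B)
    (h : m (basin f (A ∩ B)) ≠ 0) : GenAttractor D m f (A ∩ B) := by
  refine ⟨nonempty_iff_ne_empty.2 fun he => h ?_, hA.2.1.inter hB.2.1,
    fun μ hμ => hA.2.2.1 μ hμ.1, pos_iff_ne_zero.2 h⟩
  rw [he, basin_empty, measure_empty]

theorem IrreducibleGA.subset_of_measure_basin_inter_ne_zero (hA : IrreducibleGA D m f A)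
    (hB : GenAttractor D m f B) (h : m (basin f (A ∩ B)) ≠ 0) : A ⊆ B := by
  have hAB := hA.1.inter hB h
  by_contra hsub
  exact hA.2 _ hAB.2.1 (inter_ssubset_left_iff.2 hsub) hAB

/-- Every generalized attractor contains a member of any countable family of irreducible
generalized attractors whose basins cover almost every point. -/
theorem GenAttractor.exists_irreducible_subset [IsProbabilityMeasure m] (hf : Continuous f)
    (hS : S.Countable) (hirr : ∀ A ∈ S, IrreducibleGA D m f A)
    (hcov : m (⋃ A ∈ S, basin f A) = 1) (hB : GenAttractor D m f B) :
    ∃ A ∈ S, A ⊆ B := by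
  by_contra! h
  have hnull : ∀ A ∈ S, m (basin f (A ∩ B)) = 0 := fun A hA => by
    by_contra hne
    exact h A hA ((hirr A hA).subset_of_measure_basin_inter_ne_zero hB hne)
  have hmeas : MeasurableSet (⋃ A ∈ S, basin f A) :=
    MeasurableSet.biUnion hS fun A hA => measurableSet_basin hf (hirr A hA).1.2.1
  have hcompl : m (⋃ A ∈ S, basin f A)ᶜ = 0 := (prob_compl_eq_zero_iff hmeas).2 hcov
  refine hB.2.2.2.ne' (measure_mono_null (t := (⋃ A ∈ S, basin f A)ᶜ ∪
    ⋃ A ∈ S, basin f (A ∩ B)) (fun x hx => ?_)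
    (measure_union_null hcompl ((measure_biUnion_null_iff hS).2 hnull)))
  by_cases hxS : x ∈ ⋃ A ∈ S, basin f A
  · obtain ⟨A, hA, hxA⟩ := mem_iUnion₂.1 hxS
    exact Or.inr (mem_iUnion₂.2 ⟨A, hA, (basin_inter f A B).symm ▸ ⟨hxA, hx⟩⟩)
  · exact Or.inl hxS

theorem subset_of_irreducible_cover [IsProbabilityMeasure m] (hf : Continuous f)
    (hS : S.Countable) (hirr : ∀ A ∈ S, IrreducibleGA D m f A)
    (hcov : m (⋃ A ∈ S, basin f A) = 1) (hT : ∀ B ∈ T, IrreducibleGA D m f B) : T ⊆ S := by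
  intro B hB
  obtain ⟨A, hA, hAB⟩ := (hT B hB).1.exists_irreducible_subset hf hS hirr hcov
  obtain rfl | hss := hAB.eq_or_ssubset
  · exact hA
  · exact absurd (hirr A hA).1 ((hT B hB).2 A (hirr A hA).1.2.1 hss)

theorem IsCochain.mk_le_of_irreducible_cover [IsProbabilityMeasure m] (hf : Continuous f)
    (hS : S.Countable) (hirr : ∀ A ∈ S, IrreducibleGA D m f A)
    (hcov : m (⋃ A ∈ S, basin f A) = 1) (hT : IsCochain D m f T) :
    Cardinal.mk T ≤ Cardinal.mk S := by
  choose g hgS hgT using fun B : T =>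
    (hT.2.1 B B.2).exists_irreducible_subset hf hS hirr hcov
  refine Cardinal.mk_le_of_injective (f := fun B : T => (⟨g B, hgS B⟩ : S)) fun B B' h => ?_
  have hg : g B = g B' := congrArg Subtype.val h
  by_contra hne
  have hnull := hT.2.2 B.2 B'.2 (Subtype.coe_ne_coe.2 hne)
  have hsub : basin f (g B) ⊆ basin f ((B : Set (ProbabilityMeasure M)) ∩ B') := fun x hx =>
    hx.trans (subset_inter (hgT B) (hg.subset.trans (hgT B')))
  exact (hirr _ (hgS B)).1.2.2.2.ne' (measure_mono_null hsub hnull)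

end

/-- Uniqueness of the decomposition into irreducible generalized attractors: if a
co-chain `S` of irreducible generalized attractors has basins covering `m`-a.e., then `S`
is unique and its cardinality `l` satisfies `l = a = k`. -/
theorem irreducible_decomposition_unique {M : Type*} [MetricSpace M] [CompactSpace M] [MeasurableSpace M] [BorelSpace M]
    (D : CompatibleMetric (ProbabilityMeasure M))
    (m : Measure M) [IsProbabilityMeasure m]
    (f : M → M) (hf : Continuous f)
    (S : Set (Set (ProbabilityMeasure M))) (hS : IsCochain D m f S)
    (hirr : ∀ A ∈ S, IrreducibleGA D m f A)
    (hcov : m (⋃ A ∈ S, basin f A) = 1) :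
    (∀ S' : Set (Set (ProbabilityMeasure M)), IsCochain D m f S' →
        (∀ A ∈ S', IrreducibleGA D m f A) → m (⋃ A ∈ S', basin f A) = 1 → S' = S) ∧
    Cardinal.mk S =
      sSup {c : Cardinal | ∃ T : Set (Set (ProbabilityMeasure M)), IsCochain D m f T ∧
        m (⋃ A ∈ T, basin f A) = 1 ∧ c = Cardinal.mk T} ∧
    Cardinal.mk S = cochainSup D m f := by
  have hle {T : Set (Set (ProbabilityMeasure M))} (hT : IsCochain D m f T) :
      Cardinal.mk T ≤ Cardinal.mk S := hT.mk_le_of_irreducible_cover hf hS.1 hirr hcov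
  refine ⟨fun S' hS' hirr' hcov' => Subset.antisymm
    (subset_of_irreducible_cover hf hS.1 hirr hcov hirr')
    (subset_of_irreducible_cover hf hS'.1 hirr' hcov' hirr),
    Eq.symm (IsGreatest.csSup_eq ⟨?_, ?_⟩),
    Eq.symm (IsGreatest.csSup_eq ⟨?_, ?_⟩)⟩
  · exact ⟨S, hS, hcov, rfl⟩
  · rintro c ⟨T, hT, -, rfl⟩
    exact hle hT
  · exact ⟨S, hS, rfl⟩
  · rintro c ⟨T, hT, rfl⟩
    exact hle hT
end

section
/- Let 𝒜 be a generalized attractor of f with basin B = B(𝒜) (so m(B) > 0), and let A ⊆ M be the minimal compact subset of M containing the supports of all measures in 𝒜. Then for every ε > 0 there exist N ≥ 1 and a subset C ⊆ B with m(B \ C) < ε · m(B) such that for every x ∈ C and every n ≥ N, the number of indices 0 ≤ j ≤ n−1 with f^j(x) in the open ε-neighborhood of A is strictly greater than (1 − ε) · n. -/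
open MeasureTheory Filter Set Topology
open scoped ENNReal NNReal

variable {M : Type*} [MeasurableSpace M] [TopologicalSpace M] [OpensMeasurableSpace M]

open scoped Classical

/-- Integrating against an empirical measure gives a Birkhoff average. -/
theorem integral_empiric {M : Type*} [MetricSpace M] [MeasurableSpace M] [BorelSpace M]
    (f : M → M) (x : M) (n : ℕ) (g : M → ℝ) :
    ∫ y, g y ∂(empiric f x n : Measure M) =
      ((n : ℝ) + 1)⁻¹ * ∑ j ∈ Finset.range (n + 1), g (f^[j] x) := by
  change ∫ y, g y ∂(((n : ℝ≥0∞) + 1)⁻¹ • ∑ j ∈ Finset.range (n + 1), Measure.dirac (f^[j] x)) = _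
  rw [integral_smul_measure, integral_finsetSum_measure fun j _ => integrable_dirac (by simp)]
  simp only [integral_dirac, smul_eq_mul]
  congr 1
  rw [ENNReal.toReal_inv, ENNReal.toReal_add (by simp) (by simp)]
  simp

/-- A continuous function with integral less than `ε` against every limit point of the
empirical measures of `x` eventually has Birkhoff averages less than `ε` along the orbit. -/
theorem eventually_birkhoffSum_lt {M : Type*} [MetricSpace M] [CompactSpace M]
    [MeasurableSpace M] [BorelSpace M] (f : M → M) (x : M) (g : C(M, ℝ)) {ε : ℝ}
    (h : ∀ μ ∈ pomega f x, ∫ y, g y ∂(μ : Measure M) < ε) :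
    ∀ᶠ n in atTop, birkhoffSum f g n x < ε * n := by
  have hcont : Continuous fun μ : ProbabilityMeasure M => ∫ y, g y ∂(μ : Measure M) :=
    ProbabilityMeasure.continuous_integral_boundedContinuousFunction
      (BoundedContinuousFunction.mkOfCompact g)
  have hev : ∀ᶠ n in atTop, ∫ y, g y ∂(empiric f x n : Measure M) < ε := by
    by_contra hfreq
    obtain ⟨μ, hμ, hcl⟩ := (isClosed_le continuous_const hcont).isCompact
      |>.exists_mapClusterPt_of_frequently (l := atTop) (f := empiric f x)
        (s := {μ : ProbabilityMeasure M | ε ≤ ∫ y, g y ∂(μ : Measure M)})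
        ((not_eventually.1 hfreq).mono fun _ => not_lt.1)
    exact (h μ hcl).not_ge hμ
  rw [← map_add_atTop_eq_nat 1, eventually_map]
  filter_upwards [hev] with n hn
  rw [integral_empiric, inv_mul_lt_iff₀ (by positivity)] at hn
  rw [birkhoffSum, mul_comm]
  exact_mod_cast hn

/-- If `g` is nonnegative and at least `1` off `U`, a Birkhoff sum of `g` less than `ε * n`
forces more than `(1 - ε) * n` visits to `U`. -/
theorem lt_card_visits_of_birkhoffSum_lt {M : Type*} {f : M → M} {x : M} {g : M → ℝ}
    {U : Set M} (hg : ∀ y, 0 ≤ g y) (hU : ∀ y ∉ U, 1 ≤ g y) {ε : ℝ} {n : ℕ}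
    (h : birkhoffSum f g n x < ε * n) :
    (1 - ε) * (n : ℝ) < ((Finset.range n).filter (fun j => f^[j] x ∈ U)).card := by
  have hsum : ∑ j ∈ Finset.range n, (1 - if f^[j] x ∈ U then (1 : ℝ) else 0) ≤
      birkhoffSum f g n x := by
    refine Finset.sum_le_sum fun j _ => ?_
    split_ifs with hj
    · simpa using hg _
    · simpa using hU _ hj
  rw [Finset.sum_sub_distrib, Finset.sum_boole] at hsum
  simp only [Finset.sum_const, Finset.card_range, nsmul_eq_mul, mul_one] at hsum
  linarith

/-- If every point of `B` eventually satisfies the measurable conditions `p n`, then the part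
of `B` on which they are not yet all satisfied from time `N` on has measure tending to `0`. -/
theorem tendsto_measure_diff_forall_ge {X : Type*} [MeasurableSpace X] (m : Measure X)
    [IsFiniteMeasure m] {B : Set X} {p : ℕ → X → Prop}
    (hp : ∀ n, MeasurableSet {x | p n x}) (hB : ∀ x ∈ B, ∀ᶠ n in atTop, p n x) :
    Tendsto (fun N => m (B \ {x | ∀ n ≥ N, p n x})) atTop (𝓝 0) := by
  have hmeas (N : ℕ) : MeasurableSet {x | ∀ n ≥ N, p n x} := by
    simp only [ofPred_forall]
    exact .iInter fun n => .iInter fun _ => hp n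
  have hlim := tendsto_measure_iInter_atTop (μ := m.restrict B)
    (s := fun N => {x | ∀ n ≥ N, p n x}ᶜ) (fun N => (hmeas N).compl.nullMeasurableSet)
    (fun N N' hN => compl_subset_compl.2 fun x hx n hn => hx n (hN.trans hn))
    ⟨0, measure_ne_top _ _⟩
  have hempty : (⋂ N, {x | ∀ n ≥ N, p n x}ᶜ) ∩ B = ∅ := by
    refine eq_empty_of_forall_notMem fun x hx => ?_
    obtain ⟨N, hN⟩ := eventually_atTop.1 (hB x hx.2)
    exact mem_iInter.1 hx.1 N hN
  rw [Measure.restrict_apply (.iInter fun N => (hmeas N).compl), hempty, measure_empty] at hlim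
  refine hlim.congr fun N => ?_
  rw [Function.comp_apply, Measure.restrict_apply (hmeas N).compl, inter_comm, sdiff_eq]

/-- Topological attraction in mean: given a generalized attractor `𝒜` with basin `B` and
`A ⊆ M` the minimal compact set containing the supports of all measures of `𝒜`, for every
`ε > 0` there are `N ≥ 1` and `C ⊆ B` with `m(B \ C) < ε·m(B)` such that for `x ∈ C` and
`n ≥ N`, more than `(1-ε)n` of the first `n` iterates of `x` lie in the open
`ε`-neighborhood of `A`. -/
theorem attraction_in_mean {M : Type*} [MetricSpace M] [CompactSpace M] [MeasurableSpace M] [BorelSpace M]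
    (D : CompatibleMetric (ProbabilityMeasure M))
    (m : Measure M) [IsProbabilityMeasure m]
    (f : M → M) (hf : Continuous f)
    (𝒜 : Set (ProbabilityMeasure M)) (hGA : GenAttractor D m f 𝒜)
    (A : Set M) (hAcomp : IsCompact A)
    (hsupp : ∀ μ ∈ 𝒜, μ.toMeasure Aᶜ = 0)
    (hmin : ∀ A' : Set M, IsCompact A' → (∀ μ ∈ 𝒜, μ.toMeasure A'ᶜ = 0) → A ⊆ A') :
    ∀ ε : ℝ, 0 < ε → ∃ N : ℕ, 1 ≤ N ∧ ∃ C ⊆ basin f 𝒜,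
      m (basin f 𝒜 \ C) < ENNReal.ofReal ε * m (basin f 𝒜) ∧
      ∀ x ∈ C, ∀ n ≥ N,
        (1 - ε) * (n : ℝ) <
          ((Finset.range n).filter (fun j => f^[j] x ∈ Metric.thickening ε A)).card := by
  intro ε hε
  obtain ⟨g, hg0, hg1, hg01⟩ := exists_continuous_zero_one_of_isClosed hAcomp.isClosed
    (Metric.isOpen_thickening (δ := ε) (E := A)).isClosed_compl
    (disjoint_compl_right_iff_subset.2 (Metric.self_subset_thickening hε A))
  have hint (μ : ProbabilityMeasure M) (hμ : μ ∈ 𝒜) : ∫ y, g y ∂(μ : Measure M) = 0 :=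
    integral_eq_zero_of_ae <| by
      filter_upwards [mem_ae_iff.2 (hsupp μ hμ)] with y hy using hg0 hy
  have hmeas (n : ℕ) : MeasurableSet {x | birkhoffSum f g n x < ε * n} := by
    have hcont : Continuous (birkhoffSum f g n) :=
      continuous_finsetSum _ fun j _ => g.continuous.comp (hf.iterate j)
    exact (isOpen_lt hcont continuous_const).measurableSet
  have hlim := tendsto_measure_diff_forall_ge m hmeas (B := basin f 𝒜) fun x hx =>
    eventually_birkhoffSum_lt f x g fun μ hμ => (hint μ (hx hμ)).trans_lt hε
  have hpos : 0 < ENNReal.ofReal ε * m (basin f 𝒜) :=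
    ENNReal.mul_pos (ENNReal.ofReal_pos.2 hε).ne' hGA.2.2.2.ne'
  obtain ⟨N, hN, hN1⟩ := ((hlim.eventually_lt_const hpos).and (eventually_ge_atTop 1)).exists
  refine ⟨N, hN1, basin f 𝒜 ∩ {x | ∀ n ≥ N, birkhoffSum f g n x < ε * n}, inter_subset_left,
    by rwa [sdiff_self_inter], fun x hx n hn => ?_⟩
  exact lt_card_visits_of_birkhoffSum_lt (fun y => (hg01 y).1) (fun y hy => (hg1 hy).ge)
    (hx.2 n hn)
end
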